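/- arXiv:1607.01579 — 6 statements merged into one kernel-verified Lean document; each statement's English description precedes it below -/
import Mathlib

section
/- Let N ∈ ℂ^{m×n}, and let X ∈ ℂ^{m×m}, Y ∈ ℂ^{n×n} be invertible matrices, and set M = XNY. If X·E_N = E_N and F_N·Y = F_N, then M† = (I + L*)(I + LL*)^{-1} Y^{-1} N† X^{-1} (I + R*R)^{-1}(I + R*), where R = E_N(I − X^{-1}) and L = (I − Y^{-1})F_N (the matrices I + LL* and I + R*R are invertible since they are of the form identity plus positive semidefinite). -/
open Matrix

/-- `Z` is the Moore–Penrose inverse of `A`. -/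
def IsMP {m n : Type*} [Fintype m] [Fintype n]
    (A : Matrix m n ℂ) (Z : Matrix n m ℂ) : Prop :=
  A * Z * A = A ∧ Z * A * Z = Z ∧ (A * Z)ᴴ = A * Z ∧ (Z * A)ᴴ = Z * A

theorem IsMP.unique {m n : Type*} [Fintype m] [Fintype n]
    {A : Matrix m n ℂ} {Z W : Matrix n m ℂ} (hZ : IsMP A Z) (hW : IsMP A W) : Z = W := by
  obtain ⟨z1, z2, z3, z4⟩ := hZ
  obtain ⟨w1, w2, w3, w4⟩ := hW
  have h1 : A * Z = A * W := by
    calc A * Z = (A * Z)ᴴ := z3.symm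
      _ = ((A * W) * (A * Z))ᴴ := by rw [← Matrix.mul_assoc (A * W), w1]
      _ = (A * Z) * (A * W) := by rw [conjTranspose_mul, z3, w3]
      _ = A * W := by rw [← Matrix.mul_assoc (A * Z), z1]
  have h2 : Z * A = W * A := by
    calc Z * A = (Z * A)ᴴ := z4.symm
      _ = ((Z * A) * (W * A))ᴴ := by
        rw [Matrix.mul_assoc Z A (W * A), ← Matrix.mul_assoc A W A, w1]
      _ = (W * A) * (Z * A) := by rw [conjTranspose_mul, z4, w4]
      _ = W * A := by rw [Matrix.mul_assoc W A (Z * A), ← Matrix.mul_assoc A Z A, z1]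
  calc Z = Z * (A * Z) := by rw [← Matrix.mul_assoc, z2]
    _ = W * A * W := by rw [h1, ← Matrix.mul_assoc, h2]
    _ = W := w2

open scoped ComplexOrder in
theorem isUnit_one_add_conjTranspose_mul_self {n : Type*} [Fintype n] [DecidableEq n]
    (R : Matrix n n ℂ) : IsUnit (1 + Rᴴ * R) :=
  (PosDef.one.add_posSemidef (posSemidef_conjTranspose_mul_self R)).isUnit

/-- For an orthogonal projection `E` and `R = E * R * (1 - E)`, the matrix `P = 1 - E + R` is
idempotent, and `P * (1 + Rᴴ * R)⁻¹ * (1 + Rᴴ)` is the orthogonal projection onto its range. -/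
theorem orthogonal_projection_of_oblique {n : Type*} [Fintype n] [DecidableEq n]
    {E R : Matrix n n ℂ} (hE : Eᴴ = E) (hEE : E * E = E) (hER : E * R = R) (hRE : R * E = 0) :
    ((1 - E + R) * ((1 + Rᴴ * R)⁻¹ * (1 + Rᴴ)))ᴴ = (1 - E + R) * ((1 + Rᴴ * R)⁻¹ * (1 + Rᴴ)) ∧
      (1 - E + R) * ((1 + Rᴴ * R)⁻¹ * (1 + Rᴴ)) * (1 - E + R) = 1 - E + R := by
  have hu := (isUnit_iff_isUnit_det _).1 (isUnit_one_add_conjTranspose_mul_self R)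
  have hA1 := nonsing_inv_mul _ hu
  have hA2 := mul_nonsing_inv _ hu
  have hAH : ((1 + Rᴴ * R)⁻¹)ᴴ = (1 + Rᴴ * R)⁻¹ := by
    rw [conjTranspose_nonsing_inv]; simp
  set A := (1 + Rᴴ * R)⁻¹
  have hERH : E * Rᴴ = 0 := by
    have := congrArg conjTranspose hRE
    simpa [hE] using this
  have hRHE : Rᴴ * E = Rᴴ := by
    have := congrArg conjTranspose hER
    simpa [hE] using this
  have hAE : A * E = E := by
    have h : (1 + Rᴴ * R) * E = E := by
      rw [add_mul, Matrix.mul_assoc, hRE]; simp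
    calc A * E = A * ((1 + Rᴴ * R) * E) := by rw [h]
      _ = E := by rw [← Matrix.mul_assoc, hA1, Matrix.one_mul]
  have hEA : E * A = E := by
    have := congrArg conjTranspose hAE
    simpa [hE, hAH] using this
  have hPE : (1 - E + R) * E = 0 := by
    rw [add_mul, sub_mul, hEE, hRE]; simp
  have hPH : (1 - E + R)ᴴ = 1 - E + Rᴴ := by simp [hE]
  have hPP : (1 - E + Rᴴ) * (1 - E + R) = (1 + Rᴴ * R) * (1 - E) := by
    have h : Rᴴ * R * E = 0 := by rw [Matrix.mul_assoc, hRE, Matrix.mul_zero]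
    simp only [add_mul, sub_mul, mul_add, mul_sub, Matrix.one_mul, Matrix.mul_one,
      hEE, hER, hRHE, h]
    abel
  have hPK : (1 - E + R) * (A * (1 + Rᴴ)) = (1 - E + R) * A * (1 - E + Rᴴ) := by
    have h : (1 - E + R) * A * E = 0 := by rw [Matrix.mul_assoc, hAE, hPE]
    have h' : 1 - E + Rᴴ = 1 + Rᴴ - E := by abel
    rw [h', mul_sub, h, sub_zero, Matrix.mul_assoc]
  rw [hPK]
  constructor
  · rw [conjTranspose_mul, conjTranspose_mul, hAH, hPH, ← hPH, conjTranspose_conjTranspose,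
      Matrix.mul_assoc]
  · rw [Matrix.mul_assoc, hPP, ← Matrix.mul_assoc, Matrix.mul_assoc _ A, hA1, Matrix.mul_one,
      mul_sub, hPE, Matrix.mul_one, sub_zero]

/-- A reflexive generalized inverse `G` of `M`, multiplied by matrices symmetrizing the idempotents
`M * G` and `G * M`, becomes the Moore–Penrose inverse. -/
theorem IsMP.of_reflexive_inverse {m n : Type*} [Fintype m] [Fintype n]
    {M : Matrix m n ℂ} {G : Matrix n m ℂ} {J : Matrix n n ℂ} {K : Matrix m m ℂ}
    (hMGM : M * G * M = M) (hGMG : G * M * G = G)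
    (hK : (M * G * K)ᴴ = M * G * K) (hPKP : M * G * K * (M * G) = M * G)
    (hJ : (J * (G * M))ᴴ = J * (G * M)) (hQJQ : G * M * (J * (G * M)) = G * M) :
    IsMP M (J * G * K) := by
  have hMJG : M * J * G = M * G := by
    calc M * J * G = (M * G * M) * J * (G * M * G) := by rw [hMGM, hGMG]
      _ = M * (G * M * (J * (G * M))) * G := by simp only [Matrix.mul_assoc]
      _ = M * G := by rw [hQJQ, ← Matrix.mul_assoc, hMGM]
  have hGKM : G * K * M = G * M := by
    calc G * K * M = (G * M * G) * K * (M * G * M) := by rw [hMGM, hGMG]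
      _ = G * (M * G * K * (M * G)) * M := by simp only [Matrix.mul_assoc]
      _ = G * M := by rw [hPKP, ← Matrix.mul_assoc, hGMG]
  have hMW : M * (J * G * K) = M * G * K := by
    rw [← Matrix.mul_assoc, ← Matrix.mul_assoc, hMJG]
  have hWM : J * G * K * M = J * (G * M) := by
    rw [← hGKM]; simp only [Matrix.mul_assoc]
  refine ⟨?_, ?_, ?_, ?_⟩
  · rw [hMW, Matrix.mul_assoc M, Matrix.mul_assoc M, hGKM, ← Matrix.mul_assoc, hMGM]
  · calc J * G * K * M * (J * G * K) = J * (G * M) * (J * G * K) := by rw [hWM]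
      _ = J * (G * (M * J * G)) * K := by simp only [Matrix.mul_assoc]
      _ = J * G * K := by rw [hMJG, ← Matrix.mul_assoc G, hGMG]
  · rw [hMW, hK]
  · rw [hWM, hJ]

theorem stmt_0 {m n : ℕ}
    (N : Matrix (Fin m) (Fin n) ℂ)
    (X : Matrix (Fin m) (Fin m) ℂ) (Y : Matrix (Fin n) (Fin n) ℂ)
    (hX : IsUnit X) (hY : IsUnit Y)
    (Ndag : Matrix (Fin n) (Fin m) ℂ) (hNdag : IsMP N Ndag)
    (M : Matrix (Fin m) (Fin n) ℂ) (hM : M = X * N * Y)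
    (hXE : X * (1 - N * Ndag) = 1 - N * Ndag)
    (hFY : (1 - Ndag * N) * Y = 1 - Ndag * N)
    (Mdag : Matrix (Fin n) (Fin m) ℂ) (hMdag : IsMP M Mdag)
    (R : Matrix (Fin m) (Fin m) ℂ) (hR : R = (1 - N * Ndag) * (1 - X⁻¹))
    (L : Matrix (Fin n) (Fin n) ℂ) (hL : L = (1 - Y⁻¹) * (1 - Ndag * N)) :
    Mdag = (1 + Lᴴ) * (1 + L * Lᴴ)⁻¹ * Y⁻¹ * Ndag * X⁻¹ * (1 + Rᴴ * R)⁻¹ * (1 + Rᴴ) := by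
  obtain ⟨n1, n2, n3, n4⟩ := hNdag
  have hXd := (isUnit_iff_isUnit_det _).1 hX
  have hYd := (isUnit_iff_isUnit_det _).1 hY
  have hXX := nonsing_inv_mul _ hXd
  have hXX' := mul_nonsing_inv _ hXd
  have hYY := nonsing_inv_mul _ hYd
  have hYY' := mul_nonsing_inv _ hYd
  have hMG : M * (Y⁻¹ * Ndag * X⁻¹) = 1 - (1 - N * Ndag) + R := by
    calc M * (Y⁻¹ * Ndag * X⁻¹) = X * N * (Y * Y⁻¹) * Ndag * X⁻¹ := by
          simp only [hM, Matrix.mul_assoc]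
      _ = X * X⁻¹ - X * (1 - N * Ndag) * X⁻¹ := by
          rw [hYY', ← sub_mul]; simp only [mul_sub, Matrix.mul_one, sub_sub_cancel,
            Matrix.mul_assoc]
      _ = 1 - (1 - N * Ndag) + R := by
          rw [hXX', hXE, hR, mul_sub, Matrix.mul_one]; abel
  have hGM : Y⁻¹ * Ndag * X⁻¹ * M = 1 - (1 - Ndag * N) + L := by
    calc Y⁻¹ * Ndag * X⁻¹ * M = Y⁻¹ * Ndag * (X⁻¹ * X) * N * Y := by
          simp only [hM, Matrix.mul_assoc]
      _ = Y⁻¹ * Y - Y⁻¹ * ((1 - Ndag * N) * Y) := by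
          rw [hXX, ← mul_sub]; simp only [sub_mul, Matrix.one_mul, Matrix.mul_one, sub_sub_cancel,
            Matrix.mul_assoc]
      _ = 1 - (1 - Ndag * N) + L := by
          rw [hYY, hFY, hL, sub_mul, Matrix.one_mul]; abel
  have hMGM : M * (Y⁻¹ * Ndag * X⁻¹) * M = M := by
    calc _ = X * (N * (Y * Y⁻¹) * Ndag * (X⁻¹ * X) * N) * Y := by
          simp only [hM, Matrix.mul_assoc]
      _ = M := by rw [hYY', hXX, Matrix.mul_one, Matrix.mul_one, n1, hM]
  have hGMG : Y⁻¹ * Ndag * X⁻¹ * M * (Y⁻¹ * Ndag * X⁻¹) = Y⁻¹ * Ndag * X⁻¹ := by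
    calc _ = Y⁻¹ * (Ndag * (X⁻¹ * X) * N * (Y * Y⁻¹) * Ndag) * X⁻¹ := by
          simp only [hM, Matrix.mul_assoc]
      _ = _ := by rw [hYY', hXX, Matrix.mul_one, Matrix.mul_one, n2]
  have hE : (1 - N * Ndag)ᴴ = 1 - N * Ndag := by rw [conjTranspose_sub, n3, conjTranspose_one]
  have hF : (1 - Ndag * N)ᴴ = 1 - Ndag * N := by rw [conjTranspose_sub, n4, conjTranspose_one]
  have hEE : (1 - N * Ndag) * (1 - N * Ndag) = 1 - N * Ndag := by
    rw [mul_sub, sub_mul 1 _ (N * Ndag), ← Matrix.mul_assoc (N * Ndag), n1]; simp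
  have hFF : (1 - Ndag * N) * (1 - Ndag * N) = 1 - Ndag * N := by
    rw [mul_sub, sub_mul 1 _ (Ndag * N), ← Matrix.mul_assoc (Ndag * N), n2]; simp
  generalize 1 - N * Ndag = E at *
  generalize 1 - Ndag * N = F at *
  have hER : E * R = R := by rw [hR, ← Matrix.mul_assoc, hEE]
  have hLF : L * F = L := by rw [hL, Matrix.mul_assoc, hFF]
  have hRE : R * E = 0 := by
    have h : X⁻¹ * E = E := by rw [← hXE, ← Matrix.mul_assoc, hXX, Matrix.one_mul, hXE]
    rw [hR, Matrix.mul_assoc, sub_mul, h, Matrix.one_mul, sub_self, Matrix.mul_zero]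
  have hFL : F * L = 0 := by
    have h : F * Y⁻¹ = F := by rw [← hFY, Matrix.mul_assoc, hYY', Matrix.mul_one, hFY]
    rw [hL, ← Matrix.mul_assoc, mul_sub, h, Matrix.mul_one, sub_self, Matrix.zero_mul]
  obtain ⟨k1, k2⟩ := orthogonal_projection_of_oblique hE hEE hER hRE
  obtain ⟨j1, j2⟩ := orthogonal_projection_of_oblique (R := Lᴴ) hF hFF
    (by rw [← hF, ← conjTranspose_mul, hLF]) (by rw [← hF, ← conjTranspose_mul, hFL]; simp)
  have hJH : ((1 - F + Lᴴ) * ((1 + L * Lᴴ)⁻¹ * (1 + L)))ᴴ =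
      (1 + Lᴴ) * (1 + L * Lᴴ)⁻¹ * (1 - F + L) := by
    simp [conjTranspose_nonsing_inv, hF, Matrix.mul_assoc]
  rw [conjTranspose_conjTranspose] at j1 j2
  have j3 := congrArg conjTranspose j2
  rw [conjTranspose_mul, hJH] at j3
  rw [hJH] at j1
  have hPH : (1 - F + Lᴴ)ᴴ = 1 - F + L := by simp [hF]
  rw [hPH] at j3
  have key : IsMP M ((1 + Lᴴ) * (1 + L * Lᴴ)⁻¹ * (Y⁻¹ * Ndag * X⁻¹) *
      ((1 + Rᴴ * R)⁻¹ * (1 + Rᴴ))) := by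
    apply IsMP.of_reflexive_inverse hMGM hGMG
    · rw [hMG]; exact k1
    · rw [hMG]; exact k2
    · rw [hGM, j1, hJH, j1]
    · rw [hGM]; exact j3
  rw [hMdag.unique key]
  simp only [Matrix.mul_assoc]
end

section
/- Let A ∈ ℂ^{m×n}, U ∈ ℂ^{m×r}, V ∈ ℂ^{n×r}, and define the block matrices X = [[I, −U], [0, I]] ∈ ℂ^{(m+r)×(m+r)} and N = [[A, U], [−V*, I]] ∈ ℂ^{(m+r)×(n+r)}. If R(U) ⊆ R(A) and R(V) ⊆ R(A*), then X·E_N = E_N if and only if R(U*) ⊆ R(S_A), where S_A = I + V*A†U. -/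
open Matrix

open scoped ComplexOrder

/-- Inclusion of column spaces gives a factorization. -/
theorem exists_eq_mul_of_range_mulVecLin_le {m n k R : Type*} [Fintype n] [Fintype k]
    [DecidableEq k] [CommSemiring R] {B : Matrix m k R} {A : Matrix m n R}
    (h : LinearMap.range B.mulVecLin ≤ LinearMap.range A.mulVecLin) :
    ∃ W : Matrix n k R, B = A * W := by
  have hcol (j : k) : ∃ w : n → R, A *ᵥ w = B.col j := by
    obtain ⟨w, hw⟩ := h ⟨Pi.single j 1, rfl⟩
    exact ⟨w, by simpa using hw⟩
  choose w hw using hcol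
  refine ⟨(Matrix.of w)ᵀ, ?_⟩
  ext i j
  exact (congrFun (hw j) i).symm

theorem range_mulVecLin_mul_le {m n k R : Type*} [Fintype n] [Fintype k] [CommSemiring R]
    (A : Matrix m n R) (W : Matrix n k R) :
    LinearMap.range (A * W).mulVecLin ≤ LinearMap.range A.mulVecLin := by
  rw [Matrix.mulVecLin_mul]
  exact LinearMap.range_comp_le_range _ _

theorem stmt_2 {m n r : ℕ}
    (A : Matrix (Fin m) (Fin n) ℂ) (U : Matrix (Fin m) (Fin r) ℂ)
    (V : Matrix (Fin n) (Fin r) ℂ)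
    (Adag : Matrix (Fin n) (Fin m) ℂ) (hAdag : IsMP A Adag)
    (X : Matrix (Fin m ⊕ Fin r) (Fin m ⊕ Fin r) ℂ) (hX : X = Matrix.fromBlocks 1 (-U) 0 1)
    (N : Matrix (Fin m ⊕ Fin r) (Fin n ⊕ Fin r) ℂ) (hN : N = Matrix.fromBlocks A U (-Vᴴ) 1)
    (Ndag : Matrix (Fin n ⊕ Fin r) (Fin m ⊕ Fin r) ℂ) (hNdag : IsMP N Ndag)
    (S : Matrix (Fin r) (Fin r) ℂ) (hS : S = 1 + Vᴴ * Adag * U)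
    (hU : LinearMap.range U.mulVecLin ≤ LinearMap.range A.mulVecLin)
    (hV : LinearMap.range V.mulVecLin ≤ LinearMap.range Aᴴ.mulVecLin) :
    X * (1 - N * Ndag) = 1 - N * Ndag ↔
      LinearMap.range Uᴴ.mulVecLin ≤ LinearMap.range S.mulVecLin := by
  obtain ⟨hA, -, -, -⟩ := hAdag
  obtain ⟨hN₁, -, hN₃, -⟩ := hNdag
  obtain ⟨Y, hY⟩ := exists_eq_mul_of_range_mulVecLin_le hU
  obtain ⟨Z, hZ⟩ := exists_eq_mul_of_range_mulVecLin_le hV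
  have hAU : A * (Adag * U) = U := by
    rw [hY, ← Matrix.mul_assoc, ← Matrix.mul_assoc, hA]
  have hVA : Vᴴ * Adag * A = Vᴴ := by
    rw [hZ, conjTranspose_mul, conjTranspose_conjTranspose, Matrix.mul_assoc, Matrix.mul_assoc,
      ← Matrix.mul_assoc A, hA]
  have hS' : Vᴴ * Adag * U = S - 1 := by rw [hS]; abel
  obtain ⟨a, b, c, d, hE⟩ : ∃ a b c d, 1 - N * Ndag = fromBlocks a b c d :=
    ⟨_, _, _, _, (fromBlocks_toBlocks _).symm⟩
  have hEN : fromBlocks a b c d * N = 0 := by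
    rw [← hE, Matrix.sub_mul, hN₁, Matrix.one_mul, sub_self]
  have hEH : (fromBlocks a b c d)ᴴ = fromBlocks a b c d := by
    rw [← hE, conjTranspose_sub, conjTranspose_one, hN₃]
  have hEE : fromBlocks a b c d * fromBlocks a b c d = fromBlocks a b c d := by
    nth_rw 2 [← hE]
    rw [Matrix.mul_sub, Matrix.mul_one, ← Matrix.mul_assoc, hEN, Matrix.zero_mul, sub_zero]
  rw [hN, fromBlocks_multiply, ← fromBlocks_zero, fromBlocks_inj] at hEN
  obtain ⟨-, hab, hcd, hcU⟩ := hEN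
  rw [fromBlocks_conjTranspose, fromBlocks_inj] at hEH
  obtain ⟨-, hcb, hbc, -⟩ := hEH
  rw [Matrix.mul_one] at hab hcU
  rw [hE, hX, fromBlocks_multiply, fromBlocks_inj]
  constructor
  · rintro ⟨hUc, -⟩
    replace hUc : U * c = 0 := by simpa using hUc
    have hbU : b * Uᴴ = 0 := by
      rw [← hcb, ← conjTranspose_mul, hUc, conjTranspose_zero]
    have hb : b = 0 := by
      rw [eq_neg_of_add_eq_zero_right hab, Matrix.neg_mul, neg_eq_zero,
        Matrix.mul_assoc, mul_self_mul_conjTranspose_eq_zero] at hbU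
      simpa [hbU] using hab
    have hd : d = 0 := by
      rw [← hbc, hb] at hcU
      simpa using hcU
    obtain ⟨p, q, s, t, hP⟩ : ∃ p q s t, Ndag = fromBlocks p q s t :=
      ⟨_, _, _, _, (fromBlocks_toBlocks _).symm⟩
    have hNP : N * Ndag = 1 - fromBlocks a b c d := by rw [← hE]; abel
    rw [hN, hP, fromBlocks_multiply, ← fromBlocks_one, sub_eq_add_neg, fromBlocks_neg,
      fromBlocks_add, fromBlocks_inj] at hNP
    obtain ⟨-, hq, -, ht⟩ := hNP
    rw [hb, neg_zero, add_zero] at hq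
    rw [hd, neg_zero, add_zero, Matrix.neg_mul, Matrix.one_mul] at ht
    have hSt : S * t = 1 := by
      have h := congrArg (Vᴴ * Adag * ·) hq
      simp only [Matrix.mul_add, ← Matrix.mul_assoc, Matrix.mul_zero] at h
      rw [hVA, hS', Matrix.sub_mul, Matrix.one_mul] at h
      rw [← ht, ← sub_eq_zero, ← h]
      abel
    have hUS : Uᴴ = S * (t * Uᴴ) := by rw [← Matrix.mul_assoc, hSt, Matrix.one_mul]
    rw [hUS]
    exact range_mulVecLin_mul_le _ _
  · intro h
    obtain ⟨W, hW⟩ := exists_eq_mul_of_range_mulVecLin_le h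
    have hdS : d * S = 0 := by
      have h := congrArg (· * (Adag * U)) hcd
      simp only [Matrix.add_mul, Matrix.mul_assoc, Matrix.zero_mul, hAU] at h
      rw [Matrix.neg_mul, ← Matrix.mul_assoc Vᴴ, hS', eq_neg_of_add_eq_zero_left hcU,
        Matrix.mul_neg, Matrix.mul_sub, Matrix.mul_one] at h
      rw [← neg_eq_zero, ← h]
      abel
    have hcU₀ : c * U = 0 := by
      rw [← mul_self_mul_conjTranspose_eq_zero, ← Matrix.mul_assoc, eq_neg_of_add_eq_zero_left hcU, Matrix.neg_mul,
        hW, ← Matrix.mul_assoc, hdS, Matrix.zero_mul, neg_zero]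
    have hd : d = 0 := by simpa [hcU₀] using hcU
    have hc : c = 0 := by
      rw [fromBlocks_multiply, fromBlocks_inj] at hEE
      obtain ⟨-, -, -, h⟩ := hEE
      rw [hd, Matrix.mul_zero, add_zero, ← hcb] at h
      exact self_mul_conjTranspose_eq_zero.mp h
    simp [hc, hd]
end

section
/- Let A ∈ ℂ^{m×n}, U ∈ ℂ^{m×r}, V ∈ ℂ^{n×r}, and S_A = I + V*A†U. If R(U) ⊆ R(A), R(V) ⊆ R(A*), R(U*) ⊆ R(S_A), and R(V*) ⊆ R(S_A*), then the Moore–Penrose inverse of A + UV* is given by (A + UV*)† = (I + A†U F_{S_A} U*(A†)*)^{-1} (A† − A†U S_A† V*A†) (I + (A†)* V E_{S_A} V*A†)^{-1}, where the two outer factors are invertible since they are of the form identity plus positive semidefinite. -/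
open Matrix

/-- If `Z` is an inner inverse of `C`, then `C * Z` fixes every matrix whose range lies in that
of `C`. -/
theorem mul_mul_eq_of_range_le {m n k : Type*} [Fintype m] [Fintype n] [Fintype k]
    {C : Matrix m n ℂ} {Z : Matrix n m ℂ} {B : Matrix m k ℂ} (hC : C * Z * C = C)
    (h : LinearMap.range B.mulVecLin ≤ LinearMap.range C.mulVecLin) : C * Z * B = B := by
  classical
  refine ext_of_mulVec_single fun j => ?_
  obtain ⟨y, hy⟩ := h (LinearMap.mem_range_self B.mulVecLin (Pi.single j 1))
  simp only [mulVecLin_apply] at hy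
  rw [← mulVec_mulVec, ← hy, mulVec_mulVec, hC]

theorem stmt_4 {m n r : ℕ}
    (A : Matrix (Fin m) (Fin n) ℂ) (U : Matrix (Fin m) (Fin r) ℂ)
    (V : Matrix (Fin n) (Fin r) ℂ)
    (Adag : Matrix (Fin n) (Fin m) ℂ) (hAdag : IsMP A Adag)
    (S : Matrix (Fin r) (Fin r) ℂ) (hS : S = 1 + Vᴴ * Adag * U)
    (Sdag : Matrix (Fin r) (Fin r) ℂ) (hSdag : IsMP S Sdag)
    (hU : LinearMap.range U.mulVecLin ≤ LinearMap.range A.mulVecLin)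
    (hV : LinearMap.range V.mulVecLin ≤ LinearMap.range Aᴴ.mulVecLin)
    (hUs : LinearMap.range Uᴴ.mulVecLin ≤ LinearMap.range S.mulVecLin)
    (hVs : LinearMap.range Vᴴ.mulVecLin ≤ LinearMap.range Sᴴ.mulVecLin) :
    IsMP (A + U * Vᴴ)
      ((1 + Adag * U * (1 - Sdag * S) * Uᴴ * Adagᴴ)⁻¹ *
        (Adag - Adag * U * Sdag * Vᴴ * Adag) *
        (1 + Adagᴴ * V * (1 - S * Sdag) * Vᴴ * Adag)⁻¹) := by
  obtain ⟨hA₁, hA₂, hA₃, hA₄⟩ := hAdag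
  obtain ⟨hS₁, -, -, hS₄⟩ := hSdag
  have hAU : A * Adag * U = U := mul_mul_eq_of_range_le hA₁ hU
  have hVA : Vᴴ * Adag * A = Vᴴ := by
    have h := mul_mul_eq_of_range_le (Z := Adagᴴ)
      (by simpa [Matrix.mul_assoc] using congrArg conjTranspose hA₁) hV
    simpa [Matrix.mul_assoc] using congrArg conjTranspose h
  have hSV : Sdag * S * Vᴴ = Vᴴ := by
    have h := mul_mul_eq_of_range_le (Z := Sdagᴴ)
      (by simpa [Matrix.mul_assoc] using congrArg conjTranspose hS₁) hVs
    rwa [← conjTranspose_mul, hS₄] at h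
  -- The condition on the range of `Vᴴ` forces `S` to be invertible, with inverse `Sdag`.
  have hdS : Sdag * S = 1 := by
    have h : (1 - Sdag * S) * S = 1 - Sdag * S := by
      conv_lhs => rw [hS, Matrix.mul_add, Matrix.mul_one, ← hS]
      rw [← Matrix.mul_assoc, ← Matrix.mul_assoc, Matrix.sub_mul _ _ Vᴴ, hSV]
      simp
    have h₀ : S * (1 - Sdag * S) = 0 := by
      rw [Matrix.mul_sub, ← Matrix.mul_assoc, hS₁, Matrix.mul_one, sub_self]
    have h₁ : (1 - Sdag * S) * (1 - Sdag * S) = 1 - Sdag * S := by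
      rw [Matrix.sub_mul, Matrix.mul_assoc, h₀, Matrix.mul_zero, sub_zero, Matrix.one_mul]
    have h₂ : 1 - Sdag * S = 0 := by
      rw [← h₁]
      nth_rw 1 [← h]
      rw [Matrix.mul_assoc, h₀, Matrix.mul_zero]
    exact (sub_eq_zero.mp h₂).symm
  have hSd : S * Sdag = 1 := mul_eq_one_comm.mp hdS
  have hVXU : Vᴴ * Adag * U = S - 1 := by rw [hS, add_sub_cancel_left]
  have hMN : (A + U * Vᴴ) * (Adag - Adag * U * Sdag * Vᴴ * Adag) = A * Adag := by
    have h : (A + U * Vᴴ) * Adag * U = U * S := by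
      rw [Matrix.add_mul, Matrix.add_mul, hAU, Matrix.mul_assoc U, Matrix.mul_assoc U,
        hVXU, Matrix.mul_sub, Matrix.mul_one, add_sub_cancel]
    rw [Matrix.mul_sub]
    simp only [← Matrix.mul_assoc (A + U * Vᴴ), h]
    rw [Matrix.mul_assoc U, hSd, Matrix.mul_one, Matrix.add_mul, add_sub_cancel_right]
  have hNM : (Adag - Adag * U * Sdag * Vᴴ * Adag) * (A + U * Vᴴ) = Adag * A := by
    have h : Vᴴ * Adag * (A + U * Vᴴ) = S * Vᴴ := by
      rw [Matrix.mul_add, hVA, ← Matrix.mul_assoc, hVXU, Matrix.sub_mul, Matrix.one_mul,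
        add_sub_cancel]
    rw [Matrix.sub_mul, Matrix.mul_assoc _ Vᴴ, Matrix.mul_assoc _ (Vᴴ * Adag), h,
      ← Matrix.mul_assoc, Matrix.mul_assoc _ Sdag, hdS, Matrix.mul_one, Matrix.mul_add,
      Matrix.mul_assoc Adag U, add_sub_cancel_right]
  simp only [hdS, hSd, sub_self, Matrix.mul_zero, Matrix.zero_mul, add_zero, inv_one,
    Matrix.one_mul, Matrix.mul_one]
  refine ⟨?_, ?_, by rw [hMN, hA₃], by rw [hNM, hA₄]⟩
  · rw [hMN, Matrix.mul_add, hA₁, ← Matrix.mul_assoc, hAU]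
  · rw [hNM, Matrix.mul_sub, hA₂]
    simp only [← Matrix.mul_assoc, hA₂]
end

section
/- Let A ∈ ℂ^{m×n}, U ∈ ℂ^{m×r}, V ∈ ℂ^{n×r}, and S_A = I + V*A†U. Assume R(U) ⊆ R(A) and R(V) ⊆ R(A*). Then the identity (A + UV*)† = (I + A†U F_{S_A} U*(A†)*)^{-1} (A† − A†U S_A† V*A†) (I + (A†)* V E_{S_A} V*A†)^{-1} holds if and only if U E_{S_A} V*A† and A†U F_{S_A} V* are both Hermitian and A†U F_{S_A} E_{S_A} V*A† = 0. -/
open Matrix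

/-- If the columns of `U` lie in the range of `A`, every inner inverse of `A` recovers `U`. -/
lemma mul_mul_eq_of_range_le_s8 {m n r : ℕ} {A : Matrix (Fin m) (Fin n) ℂ}
    {G : Matrix (Fin n) (Fin m) ℂ} {U : Matrix (Fin m) (Fin r) ℂ} (hG : A * G * A = A)
    (hU : LinearMap.range U.mulVecLin ≤ LinearMap.range A.mulVecLin) :
    A * (G * U) = U := by
  refine Matrix.ext_of_mulVec_single fun j => ?_
  obtain ⟨y, hy⟩ := hU ⟨Pi.single j 1, rfl⟩
  simp only [mulVecLin_apply] at hy
  rw [← mulVec_mulVec, ← mulVec_mulVec, ← hy, mulVec_mulVec, mulVec_mulVec, hG]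

open scoped ComplexOrder in
/-- One plus `X P Xᴴ`, with `P` an orthogonal projection, is invertible. -/
lemma isUnit_det_one_add_mul_projection_mul {n r : ℕ} (X : Matrix (Fin n) (Fin r) ℂ)
    {P : Matrix (Fin r) (Fin r) ℂ} (hP : Pᴴ = P) (hPP : P * P = P) :
    IsUnit (1 + X * P * Xᴴ).det := by
  have h : X * P * Xᴴ = (X * P) * (X * P)ᴴ := by
    rw [conjTranspose_mul, hP, Matrix.mul_assoc X P (P * Xᴴ), ← Matrix.mul_assoc P P, hPP,
      Matrix.mul_assoc]
  rw [h]
  exact (isUnit_iff_isUnit_det _).1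
    (PosDef.one.add_posSemidef (posSemidef_self_mul_conjTranspose _)).isUnit

/-- When `L` is invertible and Hermitian and `L T = T`, the matrix `T L⁻¹` is Hermitian
exactly when `T` is. -/
lemma conjTranspose_mul_inv_eq_iff {m : ℕ} {L T : Matrix (Fin m) (Fin m) ℂ}
    (hL : IsUnit L.det) (hLH : Lᴴ = L) (hLT : L * T = T) :
    (T * L⁻¹)ᴴ = T * L⁻¹ ↔ Tᴴ = T := by
  have hTL : Tᴴ * L = Tᴴ := by simpa [hLH] using congrArg conjTranspose hLT
  have hLT' : L⁻¹ * Tᴴ = T * L⁻¹ ↔ Tᴴ = T := by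
    constructor
    · intro h
      have h2 := congrArg (fun Z => L * Z * L) h
      simp only [Matrix.mul_assoc, nonsing_inv_mul L hL, Matrix.mul_one, hLT, hTL] at h2
      rwa [← Matrix.mul_assoc, mul_nonsing_inv L hL, Matrix.one_mul] at h2
    · intro h
      rw [h] at hTL ⊢
      have h1 : L⁻¹ * T = T := by
        conv_lhs => rw [← hLT]
        rw [← Matrix.mul_assoc, nonsing_inv_mul L hL, Matrix.one_mul]
      have h2 : T * L⁻¹ = T := by
        conv_lhs => rw [← hTL]
        rw [Matrix.mul_assoc, mul_nonsing_inv L hL, Matrix.mul_one]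
      rw [h1, h2]
  rw [conjTranspose_mul, conjTranspose_nonsing_inv, hLH, hLT']

/-- Scaling an inner inverse `B` of `M` by compatible invertible Hermitian factors
gives the Moore–Penrose inverse exactly when `B` itself is the Moore–Penrose inverse. -/
lemma isMP_inv_mul_mul_inv_iff {m n : ℕ} {M : Matrix (Fin m) (Fin n) ℂ}
    {B : Matrix (Fin n) (Fin m) ℂ} {K : Matrix (Fin n) (Fin n) ℂ} {L : Matrix (Fin m) (Fin m) ℂ}
    (hK : IsUnit K.det) (hL : IsUnit L.det) (hKH : Kᴴ = K) (hLH : Lᴴ = L)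
    (hMK : M * K = M) (hLM : L * M = M) (hMBM : M * B * M = M)
    (hLMB : L * (M * B) = M * B) (hBMK : B * M * K = B * M) :
    IsMP M (K⁻¹ * B * L⁻¹) ↔ (M * B)ᴴ = M * B ∧ (B * M)ᴴ = B * M ∧ B * M * B = B := by
  have hMK' : M * K⁻¹ = M := by
    conv_lhs => rw [← hMK]
    rw [Matrix.mul_assoc, mul_nonsing_inv K hK, Matrix.mul_one]
  have hLM' : L⁻¹ * M = M := by
    conv_lhs => rw [← hLM]
    rw [← Matrix.mul_assoc, nonsing_inv_mul L hL, Matrix.one_mul]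
  have hMZ : M * (K⁻¹ * B * L⁻¹) = M * B * L⁻¹ := by
    rw [← Matrix.mul_assoc, ← Matrix.mul_assoc, hMK']
  have hZM : K⁻¹ * B * L⁻¹ * M = K⁻¹ * (B * M) := by
    rw [Matrix.mul_assoc, hLM', Matrix.mul_assoc]
  have hZMZ : K⁻¹ * (B * M) * (K⁻¹ * B * L⁻¹) = K⁻¹ * B * L⁻¹ ↔ B * M * B = B := by
    have h : K⁻¹ * (B * M) * (K⁻¹ * B * L⁻¹) = K⁻¹ * (B * M * B) * L⁻¹ := by
      rw [Matrix.mul_assoc, Matrix.mul_assoc B, hMZ]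
      simp only [Matrix.mul_assoc]
    rw [h]
    refine ⟨fun h => ?_, fun h => by rw [h]⟩
    have h2 := congrArg (fun Z => K * Z * L) h
    simp only [Matrix.mul_assoc, nonsing_inv_mul L hL, Matrix.mul_one] at h2
    simpa only [← Matrix.mul_assoc, mul_nonsing_inv K hK, Matrix.one_mul] using h2
  have hright : (K⁻¹ * (B * M))ᴴ = K⁻¹ * (B * M) ↔ (B * M)ᴴ = B * M := by
    have hKT : K * (B * M)ᴴ = (B * M)ᴴ := by
      simpa only [conjTranspose_mul K, conjTranspose_mul (B * M), hKH]
        using congrArg conjTranspose hBMK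
    have h := conjTranspose_mul_inv_eq_iff hK hKH hKT
    rw [conjTranspose_conjTranspose] at h
    have h2 : (B * M)ᴴ * K⁻¹ = (K⁻¹ * (B * M))ᴴ := by
      rw [conjTranspose_mul K⁻¹, conjTranspose_nonsing_inv, hKH]
    rw [h2, conjTranspose_conjTranspose] at h
    exact eq_comm.trans (h.trans eq_comm)
  unfold IsMP
  rw [hMZ, hZM, hZMZ, hright, conjTranspose_mul_inv_eq_iff hL hLH hLMB,
    Matrix.mul_assoc (M * B), hLM', hMBM]
  tauto

theorem stmt_8 {m n r : ℕ}
    (A : Matrix (Fin m) (Fin n) ℂ) (U : Matrix (Fin m) (Fin r) ℂ)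
    (V : Matrix (Fin n) (Fin r) ℂ)
    (Adag : Matrix (Fin n) (Fin m) ℂ) (hAdag : IsMP A Adag)
    (S : Matrix (Fin r) (Fin r) ℂ) (hS : S = 1 + Vᴴ * Adag * U)
    (Sdag : Matrix (Fin r) (Fin r) ℂ) (hSdag : IsMP S Sdag)
    (ES : Matrix (Fin r) (Fin r) ℂ) (hES : ES = 1 - S * Sdag)
    (FS : Matrix (Fin r) (Fin r) ℂ) (hFS : FS = 1 - Sdag * S)
    (hU : LinearMap.range U.mulVecLin ≤ LinearMap.range A.mulVecLin)
    (hV : LinearMap.range V.mulVecLin ≤ LinearMap.range Aᴴ.mulVecLin) :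
    IsMP (A + U * Vᴴ)
        ((1 + Adag * U * FS * Uᴴ * Adagᴴ)⁻¹ *
          (Adag - Adag * U * Sdag * Vᴴ * Adag) *
          (1 + Adagᴴ * V * ES * Vᴴ * Adag)⁻¹) ↔
      ((U * ES * Vᴴ * Adag)ᴴ = U * ES * Vᴴ * Adag ∧
        (Adag * U * FS * Vᴴ)ᴴ = Adag * U * FS * Vᴴ ∧
        Adag * U * FS * ES * Vᴴ * Adag = 0) := by
  obtain ⟨hA1, hA2, hA3, hA4⟩ := hAdag
  obtain ⟨hS1, hS2, hS3, hS4⟩ := hSdag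
  have hAX : A * (Adag * U) = U := mul_mul_eq_of_range_le_s8 hA1 hU
  have hWA : Vᴴ * Adag * A = Vᴴ := by
    have hAH : Aᴴ * Adagᴴ * Aᴴ = Aᴴ := by
      simpa only [conjTranspose_mul, Matrix.mul_assoc] using congrArg conjTranspose hA1
    simpa only [conjTranspose_mul, conjTranspose_conjTranspose]
      using congrArg conjTranspose (mul_mul_eq_of_range_le_s8 hAH hV)
  have hPX : Adag * A * (Adag * U) = Adag * U := by rw [← Matrix.mul_assoc, hA2]
  have hWQ : Vᴴ * Adag * (A * Adag) = Vᴴ * Adag := by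
    rw [← Matrix.mul_assoc, hWA]
  have hVX : Vᴴ * (Adag * U) = S - 1 := by rw [hS, Matrix.mul_assoc]; abel
  have hWU : Vᴴ * Adag * U = S - 1 := by rw [hS]; abel
  have hSF : S * FS = 0 := by rw [hFS, Matrix.mul_sub, ← Matrix.mul_assoc, hS1]; simp
  have hES0 : ES * S = 0 := by rw [hES, Matrix.sub_mul, hS1]; simp
  have hFSd : FS * Sdag = 0 := by rw [hFS, Matrix.sub_mul, hS2]; simp
  have hFH : FSᴴ = FS := by rw [hFS, conjTranspose_sub, hS4, conjTranspose_one]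
  have hEH : ESᴴ = ES := by rw [hES, conjTranspose_sub, hS3, conjTranspose_one]
  have hFF : FS * FS = FS := by
    conv_lhs => enter [1]; rw [hFS]
    rw [Matrix.sub_mul, Matrix.mul_assoc, hSF]; simp
  have hEE : ES * ES = ES := by
    conv_lhs => enter [2]; rw [hES]
    rw [Matrix.mul_sub, ← Matrix.mul_assoc, hES0]; simp
  have hSSd : S * Sdag = 1 - ES := by rw [hES]; abel
  have hSdS : Sdag * S = 1 - FS := by rw [hFS]; abel
  have hKeq : 1 + Adag * U * FS * Uᴴ * Adagᴴ = 1 + (Adag * U) * FS * (Adag * U)ᴴ := by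
    simp only [conjTranspose_mul, Matrix.mul_assoc]
  have hLeq : 1 + Adagᴴ * V * ES * Vᴴ * Adag = 1 + (Vᴴ * Adag)ᴴ * ES * (Vᴴ * Adag) := by
    simp only [conjTranspose_mul, conjTranspose_conjTranspose, Matrix.mul_assoc]
  have hBeq : Adag - Adag * U * Sdag * Vᴴ * Adag
      = Adag - (Adag * U) * Sdag * (Vᴴ * Adag) := by
    simp only [Matrix.mul_assoc]
  have hTeq : U * ES * Vᴴ * Adag = U * ES * (Vᴴ * Adag) := by simp only [Matrix.mul_assoc]
  have hReq : Adag * U * FS * ES * Vᴴ * Adag = (Adag * U) * FS * ES * (Vᴴ * Adag) := by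
    simp only [Matrix.mul_assoc]
  rw [hKeq, hLeq, hBeq, hTeq, hReq]
  have hK := isUnit_det_one_add_mul_projection_mul (Adag * U) hFH hFF
  have hL := isUnit_det_one_add_mul_projection_mul (Vᴴ * Adag)ᴴ hEH hEE
  rw [conjTranspose_conjTranspose] at hL
  clear hKeq hLeq hBeq hTeq hReq
  generalize hX : Adag * U = X at *
  generalize hW : Vᴴ * Adag = W at *
  generalize hVH : Vᴴ = V' at *
  have hMX : (A + U * V') * X = U * S := by
    rw [Matrix.add_mul, Matrix.mul_assoc, hVX, hAX, Matrix.mul_sub, Matrix.mul_one]; abel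
  have hWM : W * (A + U * V') = S * V' := by
    rw [Matrix.mul_add, ← Matrix.mul_assoc, hWU, hWA, Matrix.sub_mul, Matrix.one_mul]; abel
  have hMXF : (A + U * V') * (X * FS) = 0 := by
    rw [← Matrix.mul_assoc, hMX, Matrix.mul_assoc, hSF, Matrix.mul_zero]
  have hEWM : ES * (W * (A + U * V')) = 0 := by
    rw [hWM, ← Matrix.mul_assoc, hES0, Matrix.zero_mul]
  have hMB : (A + U * V') * (Adag - X * Sdag * W) = A * Adag + U * ES * W := by
    rw [Matrix.mul_sub, ← Matrix.mul_assoc, ← Matrix.mul_assoc, hMX, Matrix.mul_assoc U S Sdag,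
      hSSd, Matrix.add_mul, Matrix.mul_assoc U V', hW, Matrix.mul_sub, Matrix.sub_mul,
      Matrix.mul_one]
    abel
  have hBM : (Adag - X * Sdag * W) * (A + U * V') = Adag * A + X * FS * V' := by
    rw [Matrix.sub_mul, Matrix.mul_assoc _ W, hWM, Matrix.mul_assoc X, ← Matrix.mul_assoc Sdag,
      hSdS, Matrix.mul_add, ← Matrix.mul_assoc Adag U, hX, Matrix.sub_mul, Matrix.one_mul,
      Matrix.mul_sub, Matrix.mul_assoc X FS]
    abel
  have hQM : A * Adag * (A + U * V') = A + U * V' := by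
    rw [Matrix.mul_add, hA1, ← Matrix.mul_assoc, Matrix.mul_assoc A Adag U, hX, hAX]
  have hMBM : (A + U * V') * (Adag - X * Sdag * W) * (A + U * V') = A + U * V' := by
    rw [hMB, Matrix.add_mul, hQM, Matrix.mul_assoc (U * ES), Matrix.mul_assoc U, hEWM,
      Matrix.mul_zero, add_zero]
  have hBMB : (Adag - X * Sdag * W) * (A + U * V') * (Adag - X * Sdag * W)
      = (Adag - X * Sdag * W) + X * FS * ES * W := by
    have h1 : Adag * A * (Adag - X * Sdag * W) = Adag - X * Sdag * W := by
      rw [Matrix.mul_sub, hA2, ← Matrix.mul_assoc, ← Matrix.mul_assoc, hPX]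
    have h2 : V' * (Adag - X * Sdag * W) = ES * W + Sdag * W := by
      rw [Matrix.mul_sub, hW, ← Matrix.mul_assoc, ← Matrix.mul_assoc, hVX, Matrix.sub_mul, hSSd,
        Matrix.one_mul, Matrix.sub_mul, Matrix.sub_mul, Matrix.one_mul]
      abel
    rw [hBM, Matrix.add_mul, h1, Matrix.mul_assoc (X * FS), h2, Matrix.mul_add,
      ← Matrix.mul_assoc (X * FS) Sdag, Matrix.mul_assoc X FS Sdag, hFSd, Matrix.mul_zero,
      Matrix.zero_mul, add_zero, ← Matrix.mul_assoc]
  have hEWU : ES * (W * U) = -ES := by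
    rw [hWU, Matrix.mul_sub, hES0, Matrix.mul_one, zero_sub]
  have hVXF : V' * (X * FS) = -FS := by
    rw [← Matrix.mul_assoc, hVX, Matrix.sub_mul, hSF, Matrix.one_mul, zero_sub]
  rw [isMP_inv_mul_mul_inv_iff hK hL ?_ ?_ ?_ ?_ hMBM ?_ ?_, hBMB, hMB, hBM, conjTranspose_add,
    conjTranspose_add, hA3, hA4, add_right_inj, add_right_inj, add_eq_left]
  · simp [hFH, Matrix.mul_assoc]
  · simp [hEH, Matrix.mul_assoc]
  · rw [Matrix.mul_add, Matrix.mul_one, ← Matrix.mul_assoc, hMXF, Matrix.zero_mul, add_zero]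
  · rw [Matrix.add_mul, Matrix.one_mul, Matrix.mul_assoc, Matrix.mul_assoc, hEWM,
      Matrix.mul_zero, add_zero]
  · have h : Wᴴ * ES * W * (A * Adag + U * ES * W) = 0 := by
      rw [Matrix.mul_add, Matrix.mul_assoc _ W, hWQ, Matrix.mul_assoc Wᴴ, Matrix.mul_assoc Wᴴ,
        Matrix.mul_assoc ES W, Matrix.mul_assoc U, ← Matrix.mul_assoc W U,
        ← Matrix.mul_assoc ES (W * U), hEWU, Matrix.neg_mul, ← Matrix.mul_assoc ES ES, hEE,
        Matrix.mul_neg, add_neg_cancel]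
    rw [hMB, Matrix.add_mul, Matrix.one_mul, h, add_zero]
  · have h : (Adag * A + X * FS * V') * (X * FS * Xᴴ) = 0 := by
      rw [Matrix.add_mul, Matrix.mul_assoc (X * FS) V', ← Matrix.mul_assoc V', hVXF,
        ← Matrix.mul_assoc (Adag * A), ← Matrix.mul_assoc (Adag * A), hPX, Matrix.neg_mul,
        Matrix.mul_neg, ← Matrix.mul_assoc (X * FS), Matrix.mul_assoc X FS FS, hFF,
        add_neg_cancel]
    rw [hBM, Matrix.mul_add, Matrix.mul_one, h, add_zero]
end

section
/- Let A ∈ ℂ^{m×n}, U ∈ ℂ^{m×r}, V ∈ ℂ^{n×r}, and S_A = I + V*A†U. If R(U) ⊆ R(A) and R(V) ⊆ R(A*), then the matrix Â = (I + A†U F_{S_A} U*(A†)*)^{-1} (A† − A†U S_A† V*A†) (I + (A†)* V E_{S_A} V*A†)^{-1} is a {1}-inverse of A + UV*, i.e. (A + UV*) Â (A + UV*) = A + UV*. -/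
open Matrix

/-- A matrix that fixes the columns of `A` fixes every matrix whose range lies in that of `A`. -/
theorem mul_eq_self_of_range_le {l m n : Type*} [Fintype l] [Fintype m] [Fintype n]
    [DecidableEq l] {P : Matrix m m ℂ} {A : Matrix m n ℂ} {B : Matrix m l ℂ} (hP : P * A = A)
    (h : LinearMap.range B.mulVecLin ≤ LinearMap.range A.mulVecLin) : P * B = B := by
  refine Matrix.ext_of_mulVec_single fun j => ?_
  obtain ⟨w, hw⟩ := h ⟨Pi.single j 1, rfl⟩
  rw [Matrix.mulVecLin_apply, Matrix.mulVecLin_apply] at hw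
  rw [← Matrix.mulVec_mulVec, ← hw, Matrix.mulVec_mulVec, hP]

open scoped ComplexOrder in
/-- For an orthogonal projection `F`, the matrix `1 + X * F * Xᴴ` is invertible. -/
theorem isUnit_det_one_add_mul_projection_mul_s9 {m r : Type*} [Fintype m] [Fintype r]
    [DecidableEq m] (X : Matrix m r ℂ) {F : Matrix r r ℂ} (hF : F * F = F) (hFh : Fᴴ = F) :
    IsUnit (1 + X * F * Xᴴ).det := by
  have h : (X * F) * (X * F)ᴴ = X * F * Xᴴ := by
    rw [Matrix.conjTranspose_mul, hFh, ← Matrix.mul_assoc, Matrix.mul_assoc X F F, hF]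
  rw [← Matrix.isUnit_iff_isUnit_det, ← h]
  exact (Matrix.PosDef.one.add_posSemidef (Matrix.posSemidef_self_mul_conjTranspose _)).isUnit

theorem stmt_9 {m n r : ℕ}
    (A : Matrix (Fin m) (Fin n) ℂ) (U : Matrix (Fin m) (Fin r) ℂ)
    (V : Matrix (Fin n) (Fin r) ℂ)
    (Adag : Matrix (Fin n) (Fin m) ℂ) (hAdag : IsMP A Adag)
    (S : Matrix (Fin r) (Fin r) ℂ) (hS : S = 1 + Vᴴ * Adag * U)
    (Sdag : Matrix (Fin r) (Fin r) ℂ) (hSdag : IsMP S Sdag)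
    (hU : LinearMap.range U.mulVecLin ≤ LinearMap.range A.mulVecLin)
    (hV : LinearMap.range V.mulVecLin ≤ LinearMap.range Aᴴ.mulVecLin)
    (Ahat : Matrix (Fin n) (Fin m) ℂ)
    (hAhat : Ahat = (1 + Adag * U * (1 - Sdag * S) * Uᴴ * Adagᴴ)⁻¹ *
      (Adag - Adag * U * Sdag * Vᴴ * Adag) *
      (1 + Adagᴴ * V * (1 - S * Sdag) * Vᴴ * Adag)⁻¹) :
    (A + U * Vᴴ) * Ahat * (A + U * Vᴴ) = A + U * Vᴴ := by
  obtain ⟨hA, -, -, hAl⟩ := hAdag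
  obtain ⟨hS₁, -, hSr, hSl⟩ := hSdag
  have hAU : A * Adag * U = U := mul_eq_self_of_range_le hA hU
  have hVA : Vᴴ * (Adag * A) = Vᴴ := by
    have h : Adag * A * V = V := by
      refine mul_eq_self_of_range_le ?_ hV
      rw [← hAl, ← conjTranspose_mul, ← Matrix.mul_assoc, hA]
    rw [← hAl, ← conjTranspose_mul, h]
  have hSF : S * (1 - Sdag * S) = 0 := by
    rw [Matrix.mul_sub, ← Matrix.mul_assoc, hS₁, Matrix.mul_one, sub_self]
  have hES : (1 - S * Sdag) * S = 0 := by
    rw [Matrix.sub_mul, hS₁, Matrix.one_mul, sub_self]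
  have hMX : (A + U * Vᴴ) * (Adag * U) = U * S := by
    rw [hS, Matrix.add_mul, ← Matrix.mul_assoc A, hAU]
    simp only [Matrix.mul_add, Matrix.mul_one, Matrix.mul_assoc]
  have hYM : Vᴴ * Adag * (A + U * Vᴴ) = S * Vᴴ := by
    rw [hS, Matrix.mul_add, Matrix.mul_assoc Vᴴ Adag A, hVA]
    simp only [Matrix.add_mul, Matrix.one_mul, Matrix.mul_assoc]
  have hP : IsUnit (1 + Adag * U * (1 - Sdag * S) * Uᴴ * Adagᴴ).det := by
    have h := isUnit_det_one_add_mul_projection_mul_s9 (Adag * U) (F := 1 - Sdag * S)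
      (by rw [Matrix.sub_mul, Matrix.mul_assoc, hSF]; simp) (by simp [hSl, -conjTranspose_mul])
    rwa [conjTranspose_mul, ← Matrix.mul_assoc] at h
  have hQ : IsUnit (1 + Adagᴴ * V * (1 - S * Sdag) * Vᴴ * Adag).det := by
    have h := isUnit_det_one_add_mul_projection_mul_s9 (Adagᴴ * V) (F := 1 - S * Sdag)
      (by rw [Matrix.mul_sub, ← Matrix.mul_assoc, hES]; simp) (by simp [hSr, -conjTranspose_mul])
    rwa [conjTranspose_mul, conjTranspose_conjTranspose, ← Matrix.mul_assoc] at h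
  have hMP : (A + U * Vᴴ) * (1 + Adag * U * (1 - Sdag * S) * Uᴴ * Adagᴴ)⁻¹ = A + U * Vᴴ := by
    have h : (A + U * Vᴴ) * (1 + Adag * U * (1 - Sdag * S) * Uᴴ * Adagᴴ) = A + U * Vᴴ := by
      rw [Matrix.mul_add, Matrix.mul_one]
      simp only [← Matrix.mul_assoc (A + U * Vᴴ)]
      rw [Matrix.mul_assoc _ Adag U, hMX, Matrix.mul_assoc U, hSF]
      simp
    conv_lhs => rw [← h]
    exact Matrix.mul_nonsing_inv_cancel_right _ _ hP
  have hQM : (1 + Adagᴴ * V * (1 - S * Sdag) * Vᴴ * Adag)⁻¹ * (A + U * Vᴴ) = A + U * Vᴴ := by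
    have h : (1 + Adagᴴ * V * (1 - S * Sdag) * Vᴴ * Adag) * (A + U * Vᴴ) = A + U * Vᴴ := by
      rw [Matrix.add_mul, Matrix.one_mul, Matrix.mul_assoc _ Vᴴ Adag, Matrix.mul_assoc _ (Vᴴ * Adag),
        hYM, ← Matrix.mul_assoc, Matrix.mul_assoc _ _ S, hES]
      simp
    conv_lhs => rw [← h]
    exact Matrix.nonsing_inv_mul_cancel_left _ _ hQ
  rw [hAhat, Matrix.mul_assoc, Matrix.mul_assoc _ _ (A + U * Vᴴ), hQM, ← Matrix.mul_assoc,
    ← Matrix.mul_assoc, hMP]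
  calc (A + U * Vᴴ) * (Adag - Adag * U * Sdag * Vᴴ * Adag) * (A + U * Vᴴ)
      = (A * Adag * (A + U * Vᴴ) + U * (Vᴴ * Adag * (A + U * Vᴴ)))
          - (A + U * Vᴴ) * (Adag * U) * Sdag * (Vᴴ * Adag * (A + U * Vᴴ)) := by
        simp only [Matrix.mul_add, Matrix.add_mul, Matrix.mul_sub, Matrix.sub_mul,
          Matrix.mul_assoc]
        abel
    _ = (A + U * Vᴴ) + U * S * Vᴴ - U * (S * Sdag * S) * Vᴴ := by
        rw [hMX, hYM, Matrix.mul_add, hA, ← Matrix.mul_assoc _ U, hAU]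
        simp only [Matrix.mul_assoc]
    _ = A + U * Vᴴ := by rw [hS₁, add_sub_cancel_right]
end

section
/- Let A ∈ ℂ^{m×n}, U ∈ ℂ^{m×r}, V ∈ ℂ^{n×r}, and S_A = I + V*A†U. Assume R(U) ⊆ R(A) and R(V) ⊆ R(A*), and let Â = (I + A†U F_{S_A} U*(A†)*)^{-1} (A† − A†U S_A† V*A†) (I + (A†)* V E_{S_A} V*A†)^{-1}. Then (A + UV*) Â is Hermitian if and only if U E_{S_A} V*A† is Hermitian. -/
open Matrix

open scoped ComplexOrder in
theorem isUnit_det_one_add_mul_conjTranspose {k l : Type*} [Fintype k] [DecidableEq k] [Fintype l]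
    (X : Matrix k l ℂ) : IsUnit (1 + X * Xᴴ).det :=
  (Matrix.isUnit_iff_isUnit_det _).1
    (Matrix.PosDef.one.add_posSemidef (Matrix.posSemidef_self_mul_conjTranspose X)).isUnit

/-- A matrix is fixed by left multiplication by `A * Z` whenever its columns lie in the range
of `A` and `Z` is an inner inverse of `A`. -/
theorem mul_mul_eq_of_range_le_s15 {k l p : Type*} [Fintype k] [Fintype l] [Fintype p]
    {A : Matrix k l ℂ} {Z : Matrix l k ℂ} {U : Matrix k p ℂ} (hA : A * Z * A = A)
    (hU : LinearMap.range U.mulVecLin ≤ LinearMap.range A.mulVecLin) : A * Z * U = U := by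
  classical
  refine Matrix.ext_of_mulVec_single fun i => ?_
  obtain ⟨y, hy⟩ := hU ⟨Pi.single i 1, rfl⟩
  simp only [Matrix.mulVecLin_apply] at hy
  rw [← Matrix.mulVec_mulVec, ← hy, Matrix.mulVec_mulVec, hA]

/-- If `Y * M = 0`, then `M * (1 + Yᴴ * Y)⁻¹` is Hermitian exactly when `M` is. -/
theorem isHermitian_mul_inv_iff {k l : Type*} [Fintype k] [DecidableEq k] [Fintype l]
    {M : Matrix k k ℂ} {Y : Matrix l k ℂ} (hYM : Y * M = 0) :
    (M * (1 + Yᴴ * Y)⁻¹)ᴴ = M * (1 + Yᴴ * Y)⁻¹ ↔ Mᴴ = M := by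
  have hN : IsUnit (1 + Yᴴ * Y).det := by
    simpa using isUnit_det_one_add_mul_conjTranspose Yᴴ
  have key : ∀ H : Matrix k k ℂ, Hᴴ = H → Y * H = 0 → H * (1 + Yᴴ * Y) = H := by
    intro H hH hYH
    have h : H * Yᴴ = 0 := by
      simpa [Matrix.conjTranspose_mul, hH] using congrArg Matrix.conjTranspose hYH
    rw [Matrix.mul_add, ← Matrix.mul_assoc, h, Matrix.zero_mul, Matrix.mul_one, add_zero]
  constructor
  · intro h
    have h1 := key _ h (by rw [← Matrix.mul_assoc, hYM, Matrix.zero_mul])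
    rw [Matrix.nonsing_inv_mul_cancel_right _ _ hN] at h1
    rwa [← h1] at h
  · intro h
    have h1 : M * (1 + Yᴴ * Y)⁻¹ = M := by
      conv_lhs => rw [← key M h hYM]
      exact Matrix.mul_nonsing_inv_cancel_right _ _ hN
    rw [h1, h]

theorem stmt_15 {m n r : ℕ}
    (A : Matrix (Fin m) (Fin n) ℂ) (U : Matrix (Fin m) (Fin r) ℂ)
    (V : Matrix (Fin n) (Fin r) ℂ)
    (Adag : Matrix (Fin n) (Fin m) ℂ) (hAdag : IsMP A Adag)
    (S : Matrix (Fin r) (Fin r) ℂ) (hS : S = 1 + Vᴴ * Adag * U)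
    (Sdag : Matrix (Fin r) (Fin r) ℂ) (hSdag : IsMP S Sdag)
    (ES : Matrix (Fin r) (Fin r) ℂ) (hES : ES = 1 - S * Sdag)
    (FS : Matrix (Fin r) (Fin r) ℂ) (hFS : FS = 1 - Sdag * S)
    (hU : LinearMap.range U.mulVecLin ≤ LinearMap.range A.mulVecLin)
    (hV : LinearMap.range V.mulVecLin ≤ LinearMap.range Aᴴ.mulVecLin)
    (Ahat : Matrix (Fin n) (Fin m) ℂ)
    (hAhat : Ahat = (1 + Adag * U * FS * Uᴴ * Adagᴴ)⁻¹ *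
      (Adag - Adag * U * Sdag * Vᴴ * Adag) *
      (1 + Adagᴴ * V * ES * Vᴴ * Adag)⁻¹) :
    ((A + U * Vᴴ) * Ahat)ᴴ = (A + U * Vᴴ) * Ahat ↔
      (U * ES * Vᴴ * Adag)ᴴ = U * ES * Vᴴ * Adag := by
  obtain ⟨hA1, hA2, hA3, -⟩ := hAdag
  obtain ⟨hS1, -, hS3, hS4⟩ := hSdag
  have hPU := mul_mul_eq_of_range_le_s15 hA1 hU
  have hVU : Vᴴ * Adag * U = S - 1 := by rw [hS]; abel
  have hEh : ESᴴ = ES := by rw [hES, Matrix.conjTranspose_sub, hS3, Matrix.conjTranspose_one]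
  have hFh : FSᴴ = FS := by rw [hFS, Matrix.conjTranspose_sub, hS4, Matrix.conjTranspose_one]
  have hES0 : ES * S = 0 := by rw [hES, sub_mul, hS1, one_mul, sub_self]
  have hSF0 : S * FS = 0 := by rw [hFS, mul_sub, ← mul_assoc, hS1, mul_one, sub_self]
  have hEE : ES * ES = ES := by
    nth_rw 2 [hES]
    rw [mul_sub, ← mul_assoc, hES0, zero_mul, mul_one, sub_zero]
  have hFF : FS * FS = FS := by
    nth_rw 1 [hFS]
    rw [sub_mul, mul_assoc, hSF0, mul_zero, one_mul, sub_zero]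
  set X := Adag * U * FS with hX
  set Y := ES * Vᴴ * Adag with hY
  have hXX : Adag * U * FS * Uᴴ * Adagᴴ = X * Xᴴ := by
    rw [hX]
    conv_lhs => rw [← hFF]
    simp only [Matrix.conjTranspose_mul, hFh, Matrix.mul_assoc]
  have hYY : Adagᴴ * V * ES * Vᴴ * Adag = Yᴴ * Y := by
    rw [hY]
    conv_lhs => rw [← hEE]
    simp only [Matrix.conjTranspose_mul, hEh, Matrix.mul_assoc, Matrix.conjTranspose_conjTranspose]
  have hUY : U * ES * Vᴴ * Adag = U * Y := by simp only [hY, Matrix.mul_assoc]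
  have hBX : (A + U * Vᴴ) * X = 0 := by
    calc (A + U * Vᴴ) * X = A * Adag * U * FS + U * (Vᴴ * Adag * U) * FS := by
          simp only [hX, Matrix.add_mul, Matrix.mul_assoc]
      _ = U * (S * FS) := by
          rw [hPU, hVU]
          simp only [Matrix.mul_sub, Matrix.sub_mul, Matrix.mul_one, Matrix.mul_assoc]
          abel
      _ = 0 := by rw [hSF0, Matrix.mul_zero]
  have hBinv : (A + U * Vᴴ) * (1 + X * Xᴴ)⁻¹ = A + U * Vᴴ := by
    have h : (A + U * Vᴴ) * (1 + X * Xᴴ) = A + U * Vᴴ := by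
      rw [Matrix.mul_add, ← Matrix.mul_assoc, hBX, Matrix.zero_mul, Matrix.mul_one, add_zero]
    conv_lhs => rw [← h]
    exact Matrix.mul_nonsing_inv_cancel_right _ _ (isUnit_det_one_add_mul_conjTranspose X)
  have hBM : (A + U * Vᴴ) * (Adag - Adag * U * Sdag * Vᴴ * Adag) = A * Adag + U * Y := by
    calc (A + U * Vᴴ) * (Adag - Adag * U * Sdag * Vᴴ * Adag)
        = A * Adag + U * Vᴴ * Adag - A * Adag * U * Sdag * Vᴴ * Adag
            - U * (Vᴴ * Adag * U) * Sdag * Vᴴ * Adag := by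
          simp only [Matrix.add_mul, Matrix.mul_sub, Matrix.mul_assoc]
          abel
      _ = A * Adag + U * Y := by
          rw [hPU, hVU, hY, hES]
          simp only [Matrix.mul_sub, Matrix.sub_mul, Matrix.mul_one, Matrix.one_mul,
            Matrix.mul_assoc]
          abel
  have hYM : Y * (A * Adag + U * Y) = 0 := by
    have hYP : Y * (A * Adag) = Y := by
      simp only [hY, Matrix.mul_assoc] at hA2 ⊢
      rw [hA2]
    calc Y * (A * Adag + U * Y) = Y + ES * (Vᴴ * Adag * U) * Y := by
          rw [Matrix.mul_add, hYP]
          simp only [hY, Matrix.mul_assoc]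
      _ = Y - ES * ES * Vᴴ * Adag := by
          rw [hVU, mul_sub, hES0, hY]
          simp only [zero_sub, mul_one, Matrix.neg_mul, Matrix.mul_assoc]
          abel
      _ = 0 := by rw [hEE, hY, sub_self]
  rw [hAhat, hXX, hYY, hUY, ← Matrix.mul_assoc, ← Matrix.mul_assoc, hBinv, hBM,
    isHermitian_mul_inv_iff hYM, Matrix.conjTranspose_add, hA3, add_right_inj]
end
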